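/- Let G be a finite simple graph with at least one edge whose complement graph is disconnected. Then α∘(G) = χ(G). -/

import Mathlib

open SimpleGraph

/-- A list of vertices forms a cycle of `G` (single edges count as cycles of length 2):
at least two vertices, no repetitions, and consecutive vertices (cyclically) adjacent. -/
def IsCycleList {V : Type*} (G : SimpleGraph V) (l : List V) : Prop :=
  2 ≤ l.length ∧ l.Nodup ∧
    ∀ i : Fin l.length,
      G.Adj (l.get i) (l.get ⟨((i : ℕ) + 1) % l.length, Nat.mod_lt _ i.pos⟩)

/-- A cycle of `G` is monotonic for a circular ordering `σ` of the vertices if, after a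
suitable rotation, its vertices appear in increasing order of position, i.e. the vertices
`u_1, …, u_k, u_1` of the cycle appear in this cyclic order in `σ`. -/
def IsMonotonicCycle {V : Type*} [Fintype V] (G : SimpleGraph V)
    (σ : V ≃ Fin (Fintype.card V)) (l : List V) : Prop :=
  IsCycleList G l ∧ ∃ r : ℕ, ((l.rotate r).map fun x => (σ x : ℕ)).Chain' (· < ·)

/-- The circular altitude of `G`: the largest `k` such that every circular ordering of
the vertices of `G` contains a monotonic cycle with at least `k` vertices. -/
noncomputable def circAltitude {V : Type*} [Fintype V] (G : SimpleGraph V) : ℕ :=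
  sSup {k | ∀ σ : V ≃ Fin (Fintype.card V), ∃ l : List V,
    IsMonotonicCycle G σ l ∧ k ≤ l.length}

/-- A list whose consecutive entries are adjacent and whose last entry is adjacent to its first
entry is a cycle. -/
theorem IsCycleList.of_isChain {V : Type*} {G : SimpleGraph V} {l : List V} (hl : l ≠ [])
    (hlen : 2 ≤ l.length) (hnd : l.Nodup) (hchain : l.IsChain G.Adj)
    (hclose : G.Adj (l.getLast hl) (l.head hl)) : IsCycleList G l := by
  refine ⟨hlen, hnd, fun i => ?_⟩
  rw [List.isChain_iff_getElem] at hchain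
  by_cases h : (i : ℕ) + 1 < l.length
  · simpa [Nat.mod_eq_of_lt h] using hchain i h
  · have hi : (i : ℕ) = l.length - 1 := by have := i.isLt; omega
    have hi' : l.length - 1 + 1 = l.length := by omega
    simpa [hi, hi', List.getLast_eq_getElem, List.head_eq_getElem] using hclose

theorem IsCycleList.isChain_rotate {V : Type*} {G : SimpleGraph V} {l : List V}
    (h : IsCycleList G l) (r : ℕ) : (l.rotate r).IsChain G.Adj := by
  rw [List.isChain_iff_getElem]
  intro i hi
  rw [List.length_rotate] at hi
  have hpos : 0 < l.length := by omega
  have := h.2.2 ⟨(i + r) % l.length, Nat.mod_lt _ hpos⟩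
  simpa [List.getElem_rotate, add_right_comm] using this

/-- A list increasing for the order that moves the positions below `c` to the end becomes
increasing for the original order after a rotation. -/
theorem exists_rotate_isChain {V : Type*} {n c : ℕ} (s : V → ℕ) (hs : ∀ x, s x < n) :
    ∀ l : List V, l.Pairwise (fun x y =>
        (if s x < c then s x + n else s x) < (if s y < c then s y + n else s y)) →
      ∃ r : ℕ, ((l.rotate r).map s).IsChain (· < ·) := by
  intro l hl
  have hsplit : ∃ l₁ l₂, l = l₁ ++ l₂ ∧ (∀ x ∈ l₁, c ≤ s x) ∧ ∀ x ∈ l₂, s x < c := by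
    induction l with
    | nil => exact ⟨[], [], by simp⟩
    | cons a l ih =>
      rw [List.pairwise_cons] at hl
      by_cases ha : s a < c
      · refine ⟨[], a :: l, rfl, by simp, ?_⟩
        intro x hx
        rcases List.mem_cons.1 hx with rfl | hx
        · exact ha
        · have h₁ := hl.1 x hx
          have h₂ := hs x
          by_contra h
          rw [if_pos ha, if_neg h] at h₁
          omega
      · obtain ⟨l₁, l₂, rfl, h₁, h₂⟩ := ih hl.2
        refine ⟨a :: l₁, l₂, rfl, ?_, h₂⟩
        intro x hx
        rcases List.mem_cons.1 hx with rfl | hx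
        · omega
        · exact h₁ x hx
  obtain ⟨l₁, l₂, rfl, h₁, h₂⟩ := hsplit
  refine ⟨l₁.length, ?_⟩
  rw [List.rotate_append_length_eq, List.isChain_iff_pairwise, List.pairwise_map,
    List.pairwise_append]
  rw [List.pairwise_append] at hl
  refine ⟨hl.2.1.imp_of_mem ?_, hl.1.imp_of_mem ?_, ?_⟩
  · intro a b ha hb h
    rw [if_pos (h₂ a ha), if_pos (h₂ b hb)] at h
    omega
  · intro a b ha hb h
    rwa [if_neg (h₁ a ha).not_gt, if_neg (h₁ b hb).not_gt] at h
  · intro a ha b hb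
    exact (h₂ a ha).trans_le (h₁ b hb)

/-- If every vertex of `A` is adjacent to every vertex outside `A`, and an ordering starts in `A`
and ends outside `A`, then some increasing cycle has at least `χ(G)` vertices. -/
theorem exists_increasing_cycle_of_join {V : Type*} [Fintype V] {G : SimpleGraph V} {A : Set V}
    (hjoin : ∀ x ∈ A, ∀ y ∉ A, G.Adj x y) (ρ : V → ℕ) (hρ : Function.Injective ρ) {v w : V}
    (hv : v ∈ A) (hw : w ∉ A) (hmin : ∀ x, ρ v ≤ ρ x) (hmax : ∀ x, ρ x ≤ ρ w) :
    ∃ l : List V, IsCycleList G l ∧ l.Pairwise (fun x y => ρ x < ρ y) ∧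
      G.chromaticNumber ≤ l.length := by
  let R : V → V → Prop := fun x y => G.Adj x y ∧ ρ x < ρ y
  let P : V → List V → Prop := fun x t =>
    (x :: t).IsChain R ∧ (x :: t).getLast (List.cons_ne_nil x t) ∉ A
  have hpw : ∀ l : List V, l.IsChain R → l.Pairwise (fun x y => ρ x < ρ y) := by
    intro l hl
    rw [← List.pairwise_map (f := ρ) (R := (· < ·)), ← List.isChain_iff_pairwise, List.isChain_map]
    exact hl.imp fun _ _ h => h.2
  have hnd : ∀ l : List V, l.IsChain R → l.Nodup := fun l hl =>
    (hpw l hl).imp fun h heq => by simp [heq] at h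
  have hlt : ∀ {x y}, x ≠ y → ρ x ≤ ρ y → ρ x < ρ y := fun hxy h =>
    lt_of_le_of_ne h fun he => hxy (hρ he)
  have hex : ∀ x, ∃ t, P x t := by
    intro x
    by_cases hx : x ∈ A
    · have hadj := hjoin x hx w hw
      exact ⟨[w], by simp [R, hadj, hlt hadj.ne (hmax x)], by simpa using hw⟩
    · exact ⟨[], by simp, by simpa using hx⟩
  have hbdd : ∀ x, BddAbove {m | ∃ t, P x t ∧ t.length = m} := by
    rintro x
    refine ⟨Fintype.card V, ?_⟩
    rintro _ ⟨t, ht, rfl⟩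
    have := (hnd _ ht.1).length_le_card
    simp only [List.length_cons] at this
    omega
  let f : V → ℕ := fun x => sSup {m | ∃ t, P x t ∧ t.length = m}
  have hf : ∀ x, ∃ t, P x t ∧ t.length = f x := by
    intro x
    obtain ⟨t, ht⟩ := hex x
    exact Nat.sSup_mem (s := {m | ∃ t, P x t ∧ t.length = m}) ⟨_, t, ht, rfl⟩ (hbdd x)
  have hstep : ∀ x y, R x y → f y < f x := by
    intro x y hxy
    obtain ⟨t, ht, hlen⟩ := hf y
    refine Nat.lt_of_succ_le (le_csSup (hbdd x) ⟨y :: t, ⟨?_, ?_⟩, by simp [hlen]⟩)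
    · exact List.isChain_cons_cons.2 ⟨hxy, ht.1⟩
    · rw [List.getLast_cons (List.cons_ne_nil y t)]
      exact ht.2
  have : Nonempty V := ⟨v⟩
  obtain ⟨x, hx⟩ := Finite.exists_max f
  have hcol : G.Colorable (f x + 1) := by
    refine ⟨Coloring.mk (fun y => ⟨f y, Nat.lt_succ_of_le (hx y)⟩) ?_⟩
    intro a b hab heq
    have heq : f a = f b := congrArg Fin.val heq
    rcases lt_or_gt_of_ne (hρ.ne hab.ne) with h | h
    · exact (hstep a b ⟨hab, h⟩).ne' heq
    · exact (hstep b a ⟨hab.symm, h⟩).ne heq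
  obtain ⟨t, ⟨htc, htl⟩, hlen⟩ := hf x
  have hχ : G.chromaticNumber ≤ ((x :: t).length : ℕ∞) := by
    rw [List.length_cons, hlen]
    exact hcol.chromaticNumber_le
  by_cases hxA : x ∈ A
  · refine ⟨x :: t, IsCycleList.of_isChain (List.cons_ne_nil x t) ?_ (hnd _ htc)
      (htc.imp fun _ _ h => h.1) (hjoin x hxA _ htl).symm, hpw _ htc, hχ⟩
    cases t with
    | nil => exact absurd hxA (by simpa using htl)
    | cons => simp
  · have hadj := hjoin v hv x hxA
    have hc : (v :: x :: t).IsChain R :=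
      List.isChain_cons_cons.2 ⟨⟨hadj, hlt hadj.ne (hmin x)⟩, htc⟩
    refine ⟨v :: x :: t, IsCycleList.of_isChain (List.cons_ne_nil _ _) (by simp) (hnd _ hc)
      (hc.imp fun _ _ h => h.1) ?_, hpw _ hc, hχ.trans ?_⟩
    · rw [List.getLast_cons (List.cons_ne_nil x t)]
      exact (hjoin v hv _ htl).symm
    · exact_mod_cast Nat.le_succ _

/-- The complement of a disconnected graph on a nonempty vertex set is a join. -/
theorem exists_join_of_compl_not_connected {V : Type*} [Nonempty V] {G : SimpleGraph V}
    (h : ¬ (Gᶜ).Connected) :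
    ∃ A : Set V, A.Nonempty ∧ Aᶜ.Nonempty ∧ ∀ x ∈ A, ∀ y ∉ A, G.Adj x y := by
  have hpre : ¬ (Gᶜ).Preconnected := fun hp => h ⟨hp⟩
  simp only [Preconnected, not_forall] at hpre
  obtain ⟨a, b, hab⟩ := hpre
  refine ⟨{x | (Gᶜ).Reachable a x}, ⟨a, Reachable.refl a⟩, ⟨b, hab⟩, fun x hx y hy => ?_⟩
  by_contra hxy
  by_cases hne : x = y
  · exact hy (hne ▸ hx)
  · exact hy (Reachable.trans hx ((compl_adj G x y).2 ⟨hne, hxy⟩).reachable)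

theorem exists_monotonicCycle_of_join {V : Type*} [Fintype V] {G : SimpleGraph V} {A : Set V}
    (hA : A.Nonempty) (hA' : Aᶜ.Nonempty) (hjoin : ∀ x ∈ A, ∀ y ∉ A, G.Adj x y)
    (σ : V ≃ Fin (Fintype.card V)) :
    ∃ l : List V, IsMonotonicCycle G σ l ∧ G.chromaticNumber ≤ l.length := by
  classical
  obtain ⟨u, hu⟩ := hA
  have hcard : 0 < Fintype.card V := Fintype.card_pos_iff.2 ⟨u⟩
  wlog h0 : σ.symm ⟨0, hcard⟩ ∉ A generalizing A u
  · obtain ⟨u', hu'⟩ := hA'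
    exact this (A := Aᶜ) (by simpa using ⟨u, hu⟩)
      (fun x hx y hy => (hjoin y (by simpa using hy) x hx).symm) u' hu' (by simpa using h0)
  have hex : ∃ c : ℕ, ∃ hc : c < Fintype.card V, σ.symm ⟨c, hc⟩ ∈ A :=
    ⟨σ u, (σ u).isLt, by simpa using hu⟩
  obtain ⟨hc, hcA⟩ := Nat.find_spec hex
  have hbelow := fun m => Nat.find_min hex (m := m)
  generalize Nat.find hex = c at hc hcA hbelow
  have hcpos : 0 < c := Nat.pos_of_ne_zero fun h => h0 (by simpa [h] using hcA)
  have hlast : c - 1 < Fintype.card V := by omega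
  obtain ⟨l, hl, hpw, hχ⟩ := exists_increasing_cycle_of_join hjoin
    (fun x => if (σ x : ℕ) < c then (σ x : ℕ) + Fintype.card V else σ x)
    (v := σ.symm ⟨c, hc⟩) (w := σ.symm ⟨c - 1, hlast⟩)
    (by
      intro x y hxy
      have hx := (σ x).isLt
      have hy := (σ y).isLt
      apply σ.injective
      apply Fin.ext
      dsimp only at hxy
      split_ifs at hxy <;> omega)
    hcA (fun h => hbelow (c - 1) (by omega) ⟨hlast, h⟩)
    (by
      intro x
      simp only [Equiv.apply_symm_apply, lt_irrefl, if_false]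
      split_ifs <;> omega)
    (by
      intro x
      have hx := (σ x).isLt
      have hlt : c - 1 < c := by omega
      simp only [Equiv.apply_symm_apply, if_pos hlt]
      split_ifs <;> omega)
  exact ⟨l, ⟨hl, exists_rotate_isChain (fun x => (σ x : ℕ)) (fun x => (σ x).isLt) l hpw⟩, hχ⟩

/-- Listing the colour classes one after the other gives a circular ordering in which no
monotonic cycle has more vertices than there are colours. -/
theorem SimpleGraph.Coloring.exists_ordering_length_le {V : Type*} [Fintype V]
    {G : SimpleGraph V} {n : ℕ} (C : G.Coloring (Fin n)) :
    ∃ σ : V ≃ Fin (Fintype.card V), ∀ l, IsMonotonicCycle G σ l → l.length ≤ n := by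
  let e := Fintype.equivFin V
  let σ := e.trans (Tuple.sort (C ∘ e.symm)).symm
  have hσ : ∀ x y, (σ x : ℕ) < σ y → C x ≤ C y := by
    intro x y h
    have := Tuple.monotone_sort (C ∘ e.symm) (Fin.le_of_lt h)
    simpa [σ] using this
  refine ⟨σ, ?_⟩
  rintro l ⟨hl, r, hr⟩
  have hr' := List.isChain_map _ |>.1 hr
  have hC : ((l.rotate r).map C).IsChain (· < ·) := by
    rw [List.isChain_map, List.isChain_iff_getElem]
    intro i hi
    exact lt_of_le_of_ne (hσ _ _ (List.isChain_iff_getElem.1 hr' i hi))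
      (C.valid (List.isChain_iff_getElem.1 (hl.isChain_rotate r) i hi))
  have := (List.isChain_iff_pairwise.1 hC).nodup.length_le_card
  simpa using this

/-- Let `G` be a finite simple graph with at least one edge whose complement graph is
disconnected.  Then `α∘(G) = χ(G)`. -/
theorem circAltitude_eq_chromaticNumber_of_compl_disconnected {V : Type*} [Fintype V]
    (G : SimpleGraph V) (hedge : ∃ a b : V, G.Adj a b)
    (hdisc : ¬ (Gᶜ).Connected) :
    (circAltitude G : ℕ∞) = G.chromaticNumber := by
  obtain ⟨a, -⟩ := hedge
  have : Nonempty V := ⟨a⟩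
  obtain ⟨A, hA, hA', hjoin⟩ := exists_join_of_compl_not_connected hdisc
  obtain ⟨n, hn⟩ := ENat.ne_top_iff_exists.1
    (chromaticNumber_ne_top_iff_exists.2 ⟨_, G.colorable_of_fintype⟩)
  obtain ⟨C⟩ : G.Colorable n := chromaticNumber_le_iff_colorable.1 hn.ge
  have hmem : n ∈ {k | ∀ σ : V ≃ Fin (Fintype.card V), ∃ l : List V,
      IsMonotonicCycle G σ l ∧ k ≤ l.length} := fun σ => by
    obtain ⟨l, hl, hχ⟩ := exists_monotonicCycle_of_join hA hA' hjoin σ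
    rw [← hn] at hχ
    exact ⟨l, hl, by exact_mod_cast hχ⟩
  have hub : ∀ k ∈ {k | ∀ σ : V ≃ Fin (Fintype.card V), ∃ l : List V,
      IsMonotonicCycle G σ l ∧ k ≤ l.length}, k ≤ n := fun k hk => by
    obtain ⟨σ, hσ⟩ := C.exists_ordering_length_le
    obtain ⟨l, hl, hkl⟩ := hk σ
    exact hkl.trans (hσ l hl)
  rw [← hn, Nat.cast_inj]
  exact IsGreatest.csSup_eq ⟨hmem, hub⟩
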